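/- Let α > 0. Define S_{m,n} = ∫_{-1}^{1} (1-x²)^{α-1} P_m^{(α,α)}(x) P_n^{(α,α)}(x) dx where P_k^{(α,α)} are Jacobi polynomials with both parameters α. Then for m ≥ n with m+n even, S_{m,n} = (4^α/α) · Γ(m+1+α)·Γ(n+1+α) / (n!·Γ(m+1+2α)). -/

import Mathlib

open Polynomial MeasureTheory

/-- An even linear functional `A` satisfying the integration by parts formula of
`(1 - x ^ 2) ^ (α - 1)`, with the polynomials orthogonal for `p ↦ A ((1 - X ^ 2) * p)` and
normalized at `1` like the ultraspherical polynomials. -/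
structure UltrasphericalSystem (α : ℝ) (A : ℝ[X] →ₗ[ℝ] ℝ) (P : ℕ → ℝ[X]) : Prop where
  alpha_pos : 0 < α
  map_comp_neg : ∀ p : ℝ[X], A (p.comp (-X)) = A p
  by_parts : ∀ p : ℝ[X], A ((1 - X ^ 2) * derivative p) = 2 * α * A (X * p)
  sq_pos : ∀ p : ℝ[X], p ≠ 0 → 0 < A ((1 - X ^ 2) * (p * p))
  natDegree : ∀ k, (P k).natDegree = k
  orthogonal : ∀ j k, j ≠ k → A ((1 - X ^ 2) * (P j * P k)) = 0
  eval_one_pos : ∀ k, 0 < (P k).eval 1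
  eval_one_succ : ∀ k : ℕ, (k + 1) * (P (k + 1)).eval 1 = (k + 1 + α) * (P k).eval 1

namespace UltrasphericalSystem

variable {α : ℝ} {A : ℝ[X] →ₗ[ℝ] ℝ} {P : ℕ → ℝ[X]}

lemma ne_zero (h : UltrasphericalSystem α A P) (k : ℕ) : P k ≠ 0 := fun h0 ↦ by
  have := h.eval_one_pos k
  simp [h0] at this

lemma coeff_ne_zero (h : UltrasphericalSystem α A P) (k : ℕ) : (P k).coeff k ≠ 0 := by
  have := leadingCoeff_ne_zero.2 (h.ne_zero k)
  rwa [leadingCoeff, h.natDegree] at this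

lemma coeff_eq_zero (h : UltrasphericalSystem α A P) {k i : ℕ} (hi : k < i) :
    (P k).coeff i = 0 :=
  coeff_eq_zero_of_natDegree_lt (by rwa [h.natDegree])

lemma orthogonal_of_degree_lt (h : UltrasphericalSystem α A P) (k : ℕ) (q : ℝ[X])
    (hq : q.degree < k) : A ((1 - X ^ 2) * (P k * q)) = 0 := by
  suffices H : ∀ d ≤ k, ∀ q : ℝ[X], q.degree < d → A ((1 - X ^ 2) * (P k * q)) = 0 from
    H k le_rfl q hq
  intro d
  induction d with
  | zero =>
    intro _ q hq
    have : q = 0 := by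
      ext i
      exact (degree_lt_iff_coeff_zero _ _).1 hq i (Nat.zero_le i)
    simp [this]
  | succ d ih =>
    intro hd q hq
    rw [degree_lt_iff_coeff_zero] at hq
    set c := q.coeff d / (P d).coeff d with hc
    have hlow : (q - C c * P d).degree < d := by
      rw [degree_lt_iff_coeff_zero]
      intro i hi
      rcases hi.eq_or_lt with rfl | hi
      · simp [hc, h.coeff_ne_zero]
      · simp [hq i hi, h.coeff_eq_zero hi]
    have h1 := ih (by omega) _ hlow
    have h2 := h.orthogonal k d (by omega)
    have h3 : (1 - X ^ 2) * (P k * q) =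
        (1 - X ^ 2) * (P k * (q - C c * P d)) + c • ((1 - X ^ 2) * (P k * P d)) := by
      rw [smul_eq_C_mul]; ring
    rw [h3, map_add, map_smul, h1, h2]
    simp

lemma comp_neg_X (h : UltrasphericalSystem α A P) (m : ℕ) :
    (P m).comp (-X) = (-1) ^ m * P m := by
  set Q := (P m).comp (-X) - (-1) ^ m * P m with hQ
  have hneg : (-1 : ℝ[X]) ^ m = C ((-1) ^ m) := by simp
  have hcoeff : ∀ i, Q.coeff i = ((-1) ^ i - (-1) ^ m) * (P m).coeff i := by
    intro i
    have hX : (-X : ℝ[X]) = C (-1) * X := by simp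
    rw [hQ, hneg, coeff_sub, coeff_C_mul, hX, comp_C_mul_X_coeff]
    ring
  have hdeg : Q.degree < m := by
    rw [degree_lt_iff_coeff_zero]
    intro i hi
    rw [hcoeff]
    rcases hi.eq_or_lt with rfl | hi
    · simp
    · simp [h.coeff_eq_zero hi]
  have hdeg' : (Q.comp (-X)).degree < m := by simpa using hdeg
  by_contra hne
  have hpos := h.sq_pos Q (sub_ne_zero.2 hne)
  have h1 := h.orthogonal_of_degree_lt m Q hdeg
  have h2 := h.orthogonal_of_degree_lt m _ hdeg'
  rw [← h.map_comp_neg] at h2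
  have h3 : ((1 - X ^ 2) * (P m * Q.comp (-X))).comp (-X) =
      (1 - X ^ 2) * ((P m).comp (-X) * Q) := by
    simp [mul_comp, sub_comp, comp_assoc]
  rw [h3] at h2
  have h4 : (1 - X ^ 2) * (Q * Q) = (1 - X ^ 2) * ((P m).comp (-X) * Q)
      - ((-1 : ℝ) ^ m) • ((1 - X ^ 2) * (P m * Q)) := by
    rw [smul_eq_C_mul, ← hneg]
    nth_rewrite 1 [hQ]
    ring
  rw [h4, map_sub, map_smul, h1, h2] at hpos
  simp at hpos

lemma map_mul_of_parity (h : UltrasphericalSystem α A P) (m : ℕ) (q : ℝ[X])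
    (hq : q.comp (-X) = (-1) ^ m * q) (hdeg : q.degree < (m + 2 : ℕ)) :
    A (P m * q) = q.eval 1 * A (P m * X ^ m) := by
  have hev : q.eval (-1) = (-1) ^ m * q.eval 1 := by
    have := congrArg (eval 1) hq
    simpa using this
  set g := q - C (q.eval 1) * X ^ m with hg
  have hg1 : g.IsRoot 1 := by simp [hg]
  have hg2 : g.IsRoot (-1) := by
    rw [IsRoot, hg]
    simp only [eval_sub, eval_mul, eval_C, eval_pow, eval_X, hev]
    ring
  have hdvd : (X - C 1) * (X - C (-1)) ∣ g := by
    refine IsCoprime.mul_dvd ?_ (dvd_iff_isRoot.2 hg1) (dvd_iff_isRoot.2 hg2)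
    exact isCoprime_X_sub_C_of_isUnit_sub (by norm_num)
  obtain ⟨r, hr⟩ := hdvd
  have hr' : g = (X ^ 2 - 1) * r := by rw [hr, C_neg, C_1]; ring
  have hgdeg : g.degree < (m + 2 : ℕ) := by
    rw [degree_lt_iff_coeff_zero] at hdeg ⊢
    intro i hi
    simp [hg, hdeg i hi, coeff_X_pow, show i ≠ m by omega]
  have hrdeg : r.degree < m := by
    by_cases hr0 : r = 0
    · simp [hr0]
    have hd : (X ^ 2 - 1 : ℝ[X]).degree = 2 := by
      have := degree_X_pow_sub_C (n := 2) (by norm_num) (1 : ℝ)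
      simpa using this
    rw [hr', degree_mul, hd, degree_eq_natDegree hr0] at hgdeg
    rw [degree_eq_natDegree hr0]
    norm_cast at hgdeg ⊢
    omega
  have h1 := h.orthogonal_of_degree_lt m r hrdeg
  have h2 : P m * q = q.eval 1 • (P m * X ^ m) - (1 - X ^ 2) * (P m * r) := by
    have : q = g + C (q.eval 1) * X ^ m := by rw [hg]; ring
    rw [smul_eq_C_mul]
    nth_rewrite 1 [this, hr']
    ring
  rw [h2, map_sub, map_smul, h1]
  simp

lemma map_mul (h : UltrasphericalSystem α A P) {m n : ℕ} (hnm : n ≤ m) (hp : Even (m + n)) :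
    A (P m * P n) = (P n).eval 1 * A (P m * X ^ m) := by
  refine h.map_mul_of_parity m _ ?_ ?_
  · rw [h.comp_neg_X]
    congr 1
    have hp := Nat.even_add.1 hp
    by_cases hm : Even m
    · rw [hm.neg_one_pow, (hp.1 hm).neg_one_pow]
    · have hn : ¬ Even n := fun hn ↦ hm (hp.2 hn)
      rw [(Nat.not_even_iff_odd.1 hm).neg_one_pow, (Nat.not_even_iff_odd.1 hn).neg_one_pow]
  · rw [degree_lt_iff_coeff_zero]
    intro i hi
    exact h.coeff_eq_zero (by omega)

lemma map_weight_mul_sq (h : UltrasphericalSystem α A P) (m : ℕ) :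
    (2 * m + 1 + 2 * α) * A ((1 - X ^ 2) * (P m * P m)) =
      2 * α * ((P m).eval 1 * A (P m * X ^ m)) := by
  have h1 := h.by_parts (X * (P m * P m))
  have hlow : (X * derivative (P m) - C (m : ℝ) * P m).degree < (m : WithBot ℕ) := by
    rw [degree_lt_iff_coeff_zero]
    intro i hi
    have hX : (X * derivative (P m)).coeff i = i * (P m).coeff i := by
      cases i with
      | zero => simp
      | succ i => rw [coeff_X_mul, coeff_derivative]; push_cast; ring
    rw [coeff_sub, hX, coeff_C_mul]
    rcases hi.eq_or_lt with rfl | hi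
    · ring
    · simp [h.coeff_eq_zero hi]
  have h2 := h.orthogonal_of_degree_lt m _ hlow
  have h3 := h.map_mul (le_refl m) ⟨m, rfl⟩
  have e1 : (1 - X ^ 2) * derivative (X * (P m * P m)) =
      (2 * m + 1 : ℝ) • ((1 - X ^ 2) * (P m * P m))
      + (2 : ℝ) • ((1 - X ^ 2) * (P m * (X * derivative (P m) - C (m : ℝ) * P m))) := by
    simp only [smul_eq_C_mul, derivative_mul, derivative_X, map_add, _root_.map_mul, map_one,
      map_ofNat]
    ring
  have e2 : X * (X * (P m * P m)) = P m * P m - (1 - X ^ 2) * (P m * P m) := by ring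
  rw [e1, e2, map_add, map_sub, map_smul, map_smul, h2, h3] at h1
  simp only [smul_eq_mul] at h1
  linarith

lemma map_mul_X_pow_succ (h : UltrasphericalSystem α A P) (m : ℕ) :
    (m + 1 + 2 * α) * A (P (m + 1) * X ^ (m + 1)) = (m + 1 + α) * A (P m * X ^ m) := by
  set r := (P (m + 1)).coeff (m + 1) / (P m).coeff m with hr
  have hr' : r * (P m).coeff m = (P (m + 1)).coeff (m + 1) :=
    div_mul_cancel₀ _ (h.coeff_ne_zero m)
  have hsq := h.map_weight_mul_sq m
  have hX : A (P (m + 1) * (X * P m)) = (P m).eval 1 * A (P (m + 1) * X ^ (m + 1)) := by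
    rw [h.map_mul_of_parity (m + 1) (X * P m)]
    · simp
    · rw [mul_comp, h.comp_neg_X, X_comp]; ring
    · rw [degree_lt_iff_coeff_zero]
      rintro (_ | i) hi
      · omega
      · rw [coeff_X_mul]; exact h.coeff_eq_zero (by omega)
  have hY : A (P m * (X * P (m + 1) + C r * ((1 - X ^ 2) * P m))) =
      (P (m + 1)).eval 1 * A (P m * X ^ m) := by
    rw [h.map_mul_of_parity m]
    · simp
    · simp only [add_comp, mul_comp, h.comp_neg_X, X_comp, C_comp, sub_comp, one_comp, pow_comp]
      ring
    · rw [degree_lt_iff_coeff_zero]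
      rintro (_ | _ | i) hi
      · omega
      · omega
      · have e : X * P (m + 1) + C r * ((1 - X ^ 2) * P m) =
            X * P (m + 1) + C r * P m - C r * (X ^ 2 * P m) := by ring
        rw [e, coeff_sub, coeff_add, coeff_X_mul, coeff_C_mul, coeff_C_mul,
          show i + 1 + 1 = i + 2 by ring, coeff_X_pow_mul, h.coeff_eq_zero (show m < i + 2 by omega)]
        rcases (show m ≤ i by omega).eq_or_lt with rfl | hi
        · rw [hr']; ring
        · rw [h.coeff_eq_zero hi, h.coeff_eq_zero (show m + 1 < i + 1 by omega)]; ring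
  have hY' : P m * (X * P (m + 1) + C r * ((1 - X ^ 2) * P m)) =
      P (m + 1) * (X * P m) + r • ((1 - X ^ 2) * (P m * P m)) := by
    rw [smul_eq_C_mul]; ring
  rw [hY', map_add, map_smul, hX, smul_eq_mul] at hY
  have hparts := h.by_parts (P m * P (m + 1))
  have hlow1 : (derivative (P m)).degree < (m + 1 : ℕ) := by
    rw [degree_lt_iff_coeff_zero]
    intro i hi
    rw [coeff_derivative, h.coeff_eq_zero (by omega), zero_mul]
  have hlow2 : (derivative (P (m + 1)) - C ((m + 1) * r) * P m).degree < m := by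
    rw [degree_lt_iff_coeff_zero]
    intro i hi
    rw [coeff_sub, coeff_derivative, coeff_C_mul]
    rcases hi.eq_or_lt with rfl | hi
    · rw [← hr']; ring
    · simp [h.coeff_eq_zero hi, h.coeff_eq_zero (show m + 1 < i + 1 by omega)]
  have ho1 := h.orthogonal_of_degree_lt _ _ hlow1
  have ho2 := h.orthogonal_of_degree_lt _ _ hlow2
  have e1 : (1 - X ^ 2) * derivative (P m * P (m + 1)) =
      (1 - X ^ 2) * (P (m + 1) * derivative (P m))
      + (1 - X ^ 2) * (P m * (derivative (P (m + 1)) - C ((m + 1) * r) * P m))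
      + ((m + 1) * r) • ((1 - X ^ 2) * (P m * P m)) := by
    rw [smul_eq_C_mul, derivative_mul]; ring
  have e2 : X * (P m * P (m + 1)) = P (m + 1) * (X * P m) := by ring
  rw [e1, e2, map_add, map_add, map_smul, ho1, ho2, hX, smul_eq_mul] at hparts
  have hpm := h.eval_one_pos m
  have hs := h.eval_one_succ m
  have hα := h.alpha_pos
  generalize A (P (m + 1) * X ^ (m + 1)) = T' at *
  generalize A (P m * X ^ m) = T at *
  generalize A ((1 - X ^ 2) * (P m * P m)) = H at *
  apply mul_left_cancel₀ hpm.ne'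
  linear_combination (m + 1 : ℝ) * hY - hparts + T * hs

end UltrasphericalSystem

section JacobiWeight

lemma intervalIntegrable_beta_integrand {α : ℝ} (hα : 0 < α) :
    IntervalIntegrable (fun x : ℝ ↦ x ^ (α - 1) * (1 - x) ^ (α - 1)) volume 0 1 := by
  have h := (Complex.betaIntegral_convergent (u := (α : ℂ)) (v := (α : ℂ)) (by simpa) (by simpa))
  rw [intervalIntegrable_iff_integrableOn_Ioo_of_le zero_le_one] at h ⊢
  refine IntegrableOn.congr_fun (f := fun x : ℝ ↦
    RCLike.re ((x : ℂ) ^ ((α : ℂ) - 1) * (1 - (x : ℂ)) ^ ((α : ℂ) - 1))) h.re (fun x hx ↦ ?_) measurableSet_Ioo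
  have h1 : (0 : ℝ) ≤ x := hx.1.le
  have h2 : (0 : ℝ) ≤ 1 - x := by linarith [hx.2]
  have e : (x : ℂ) ^ ((α : ℂ) - 1) * (1 - (x : ℂ)) ^ ((α : ℂ) - 1) =
      ((x ^ (α - 1) * (1 - x) ^ (α - 1) : ℝ) : ℂ) := by
    push_cast [Complex.ofReal_cpow h1, Complex.ofReal_cpow h2]
    rfl
  simp only [e]
  exact Complex.ofReal_re _

lemma integral_beta_integrand {α : ℝ} (hα : 0 < α) :
    ∫ x in (0 : ℝ)..1, x ^ (α - 1) * (1 - x) ^ (α - 1) =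
      Real.Gamma α * Real.Gamma α / Real.Gamma (α + α) := by
  have h := Complex.betaIntegral_eq_Gamma_mul_div (α : ℂ) α (by simpa) (by simpa)
  have e : Complex.betaIntegral α α =
      ((∫ x in (0 : ℝ)..1, x ^ (α - 1) * (1 - x) ^ (α - 1) : ℝ) : ℂ) := by
    rw [Complex.betaIntegral, ← intervalIntegral.integral_ofReal]
    refine intervalIntegral.integral_congr fun x hx ↦ ?_
    rw [Set.uIcc_of_le zero_le_one] at hx
    have h2 : (0 : ℝ) ≤ 1 - x := by linarith [hx.2]
    push_cast [Complex.ofReal_cpow hx.1, Complex.ofReal_cpow h2]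
    rfl
  rw [e, ← Complex.ofReal_add, Complex.Gamma_ofReal, Complex.Gamma_ofReal] at h
  exact_mod_cast h

lemma one_sub_sq_rpow_eq {α x : ℝ} (hx : x ∈ Set.uIcc (-1 : ℝ) 1) :
    (1 - x ^ 2) ^ (α - 1) = 4 ^ (α - 1) *
      ((1 / 2 * x + 1 / 2) ^ (α - 1) * (1 - (1 / 2 * x + 1 / 2)) ^ (α - 1)) := by
  rw [Set.uIcc_of_le (by norm_num)] at hx
  have h1 : 0 ≤ 1 / 2 * x + 1 / 2 := by linarith [hx.1]
  have h2 : 0 ≤ 1 - (1 / 2 * x + 1 / 2) := by linarith [hx.2]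
  rw [← Real.mul_rpow h1 h2, ← Real.mul_rpow (by norm_num) (mul_nonneg h1 h2)]
  ring_nf

lemma intervalIntegrable_one_sub_sq_rpow {α : ℝ} (hα : 0 < α) :
    IntervalIntegrable (fun x : ℝ ↦ (1 - x ^ 2) ^ (α - 1)) volume (-1) 1 := by
  have h := ((intervalIntegrable_beta_integrand hα).comp_add_right
    (1 / 2)).comp_mul_left (c := 1 / 2)
  norm_num at h
  refine (h.const_mul (4 ^ (α - 1))).congr fun x hx ↦ ?_
  rw [one_sub_sq_rpow_eq (Set.uIoc_subset_uIcc hx)]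

lemma integral_one_sub_sq_rpow {α : ℝ} (hα : 0 < α) :
    ∫ x in (-1 : ℝ)..1, (1 - x ^ 2) ^ (α - 1) =
      4 ^ α / α * (Real.Gamma (1 + α) * Real.Gamma (1 + α) / Real.Gamma (1 + 2 * α)) := by
  rw [intervalIntegral.integral_congr fun x hx ↦ one_sub_sq_rpow_eq hx,
    intervalIntegral.integral_const_mul,
    intervalIntegral.integral_comp_mul_add
      (fun x : ℝ ↦ x ^ (α - 1) * (1 - x) ^ (α - 1)) (by norm_num) (1 / 2)]
  norm_num
  rw [integral_beta_integrand hα, add_comm 1 α, add_comm 1 (2 * α), Real.Gamma_add_one hα.ne',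
    Real.Gamma_add_one (by positivity), Real.rpow_sub_one (by norm_num), ← two_mul]
  have : Real.Gamma (2 * α) ≠ 0 := (Real.Gamma_pos_of_pos (by positivity)).ne'
  field_simp
  norm_num

lemma one_sub_sq_rpow_sub_one_mul {α x : ℝ} (hα : 0 < α) (hx : x ∈ Set.uIcc (-1 : ℝ) 1) :
    (1 - x ^ 2) ^ (α - 1) * (1 - x ^ 2) = (1 - x ^ 2) ^ α := by
  rw [Set.uIcc_of_le (by norm_num)] at hx
  have h0 : 0 ≤ 1 - x ^ 2 := by nlinarith [hx.1, hx.2]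
  rcases h0.eq_or_lt with h0 | h0
  · rw [← h0, Real.zero_rpow hα.ne', mul_zero]
  · rw [Real.rpow_sub_one h0.ne', div_mul_cancel₀ _ h0.ne']

lemma intervalIntegrable_weight_mul_eval {α : ℝ} (hα : 0 < α) (p : ℝ[X]) :
    IntervalIntegrable (fun x : ℝ ↦ (1 - x ^ 2) ^ (α - 1) * p.eval x) volume (-1) 1 :=
  (intervalIntegrable_one_sub_sq_rpow hα).mul_continuousOn p.continuous.continuousOn

/-- Integration of polynomials over `[-1, 1]` against the weight `(1 - x ^ 2) ^ (α - 1)`. -/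
noncomputable def weightIntegral {α : ℝ} (hα : 0 < α) : ℝ[X] →ₗ[ℝ] ℝ where
  toFun p := ∫ x in (-1 : ℝ)..1, (1 - x ^ 2) ^ (α - 1) * p.eval x
  map_add' p q := by
    simp only [eval_add, mul_add]
    exact intervalIntegral.integral_add (intervalIntegrable_weight_mul_eval hα p)
      (intervalIntegrable_weight_mul_eval hα q)
  map_smul' c p := by
    simp only [eval_smul, smul_eq_mul, RingHom.id_apply, ← intervalIntegral.integral_const_mul]
    congr 1 with x
    ring

lemma weightIntegral_apply {α : ℝ} (hα : 0 < α) (p : ℝ[X]) :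
    weightIntegral hα p = ∫ x in (-1 : ℝ)..1, (1 - x ^ 2) ^ (α - 1) * p.eval x := rfl

lemma weightIntegral_comp_neg_X {α : ℝ} (hα : 0 < α) (p : ℝ[X]) :
    weightIntegral hα (p.comp (-X)) = weightIntegral hα p := by
  have h := intervalIntegral.integral_comp_neg (a := -1) (b := 1)
    (fun x : ℝ ↦ (1 - x ^ 2) ^ (α - 1) * p.eval x)
  simpa [weightIntegral_apply] using h

lemma weightIntegral_one_sub_sq_mul {α : ℝ} (hα : 0 < α) (p : ℝ[X]) :
    weightIntegral hα ((1 - X ^ 2) * p) = ∫ x in (-1 : ℝ)..1, (1 - x ^ 2) ^ α * p.eval x := by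
  rw [weightIntegral_apply]
  refine intervalIntegral.integral_congr fun x hx ↦ ?_
  simp only [← one_sub_sq_rpow_sub_one_mul hα hx, eval_mul, eval_sub, eval_one, eval_pow, eval_X]
  ring

lemma continuous_one_sub_sq_rpow {α : ℝ} (hα : 0 < α) :
    Continuous fun x : ℝ ↦ (1 - x ^ 2) ^ α :=
  (by fun_prop : Continuous fun x : ℝ ↦ 1 - x ^ 2).rpow_const fun _ ↦ Or.inr hα.le

lemma weightIntegral_by_parts {α : ℝ} (hα : 0 < α) (p : ℝ[X]) :
    weightIntegral hα ((1 - X ^ 2) * derivative p) = 2 * α * weightIntegral hα (X * p) := by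
  have key : weightIntegral hα ((1 - X ^ 2) * derivative p - (2 * α) • (X * p)) = 0 := by
    rw [weightIntegral_apply, intervalIntegral.integral_eq_sub_of_hasDerivAt_of_le
      (f := fun x : ℝ ↦ (1 - x ^ 2) ^ α * p.eval x) (by norm_num)
      ((continuous_one_sub_sq_rpow hα).mul p.continuous).continuousOn ?_
      (intervalIntegrable_weight_mul_eval hα _)]
    · simp [Real.zero_rpow hα.ne']
    · intro x hx
      have h0 : 0 < 1 - x ^ 2 := by nlinarith [hx.1, hx.2]
      have h1 : HasDerivAt (fun x : ℝ ↦ 1 - x ^ 2) (-(2 * x)) x := by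
        simpa using (hasDerivAt_pow 2 x).const_sub 1
      refine ((h1.rpow_const (p := α) (Or.inl h0.ne')).mul (p.hasDerivAt x)).congr_deriv ?_
      rw [← one_sub_sq_rpow_sub_one_mul hα
        (by rw [Set.uIcc_of_le (by norm_num)]; exact Set.Ioo_subset_Icc_self hx)]
      simp
      ring
  rw [map_sub, map_smul, smul_eq_mul] at key
  linarith

lemma weightIntegral_sq_pos {α : ℝ} (hα : 0 < α) (p : ℝ[X]) (hp : p ≠ 0) :
    0 < weightIntegral hα ((1 - X ^ 2) * (p * p)) := by
  rw [weightIntegral_one_sub_sq_mul]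
  obtain ⟨c, hc, hpc⟩ : ∃ c ∈ Set.Ioo (-1 : ℝ) 1, p.eval c ≠ 0 := by
    by_contra! H
    exact hp (p.eq_zero_of_infinite_isRoot ((Set.Ioo_infinite (by norm_num)).mono H))
  have hw : ∀ x ∈ Set.Icc (-1 : ℝ) 1, 0 ≤ 1 - x ^ 2 := fun x hx ↦ by nlinarith [hx.1, hx.2]
  refine intervalIntegral.integral_pos (by norm_num)
    ((continuous_one_sub_sq_rpow hα).mul (p * p).continuous).continuousOn ?_
    ⟨c, Set.Ioo_subset_Icc_self hc, ?_⟩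
  · intro x hx
    rw [eval_mul]
    exact mul_nonneg (Real.rpow_nonneg (hw x (Set.Ioc_subset_Icc_self hx)) _)
      (mul_self_nonneg _)
  · have : 0 < 1 - c ^ 2 := by nlinarith [hc.1, hc.2]
    rw [eval_mul]
    exact mul_pos (Real.rpow_pos_of_pos this _) (mul_self_pos.2 hpc)

end JacobiWeight

lemma ascPochhammer_eval_one_add_mul_Gamma {α : ℝ} (hα : 0 < α) (k : ℕ) :
    (ascPochhammer ℝ k).eval (1 + α) * Real.Gamma (1 + α) = Real.Gamma (k + 1 + α) := by
  induction k with
  | zero => simp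
  | succ k ih =>
    rw [ascPochhammer_succ_eval, show ((k + 1 : ℕ) : ℝ) + 1 + α = (k + 1 + α) + 1 by push_cast; ring,
      Real.Gamma_add_one (by positivity), ← ih]
    ring

theorem stmt12 (α : ℝ) (hα : 0 < α)
    (P : ℕ → Polynomial ℝ)
    (hdeg : ∀ k : ℕ, (P k).natDegree = k)
    (horth : ∀ j k : ℕ, j ≠ k →
      (∫ x in (-1 : ℝ)..1, (1 - x ^ 2) ^ α * (P j).eval x * (P k).eval x) = 0)
    (hnorm : ∀ k : ℕ,
      (P k).eval 1 = (ascPochhammer ℝ k).eval (1 + α) / (Nat.factorial k : ℝ)) :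
    ∀ m n : ℕ, n ≤ m → Even (m + n) →
      (∫ x in (-1 : ℝ)..1, (1 - x ^ 2) ^ (α - 1) * (P m).eval x * (P n).eval x) =
        (4 : ℝ) ^ α / α * (Real.Gamma (m + 1 + α) * Real.Gamma (n + 1 + α) /
          ((Nat.factorial n : ℝ) * Real.Gamma (m + 1 + 2 * α))) := by
  intro m n hnm hp
  have hasc : ∀ k : ℕ, 0 < (ascPochhammer ℝ k).eval (1 + α) :=
    fun k ↦ ascPochhammer_pos k _ (by positivity)
  have h : UltrasphericalSystem α (weightIntegral hα) P :=
    { alpha_pos := hα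
      map_comp_neg := weightIntegral_comp_neg_X hα
      by_parts := weightIntegral_by_parts hα
      sq_pos := weightIntegral_sq_pos hα
      natDegree := hdeg
      orthogonal := fun j k hjk ↦ by
        rw [weightIntegral_one_sub_sq_mul, ← horth j k hjk]
        simp only [eval_mul, mul_assoc]
      eval_one_pos := fun k ↦ by
        rw [hnorm]
        exact div_pos (hasc k) (by positivity)
      eval_one_succ := fun k ↦ by
        rw [hnorm, hnorm, ascPochhammer_succ_eval, Nat.factorial_succ]
        push_cast
        field_simp
        ring }
  have hG : ∀ x : ℝ, 0 < x → Real.Gamma x ≠ 0 := fun x hx ↦ (Real.Gamma_pos_of_pos hx).ne'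
  have hT : ∀ k : ℕ, weightIntegral hα (P k * X ^ k) =
      4 ^ α / α * (Real.Gamma (1 + α) * Real.Gamma (k + 1 + α) /
        Real.Gamma (k + 1 + 2 * α)) := by
    intro k
    induction k with
    | zero =>
      have hP : P 0 = 1 := by
        have h0 := eq_C_of_natDegree_eq_zero (hdeg 0)
        have h1 := hnorm 0
        rw [h0] at h1 ⊢
        have h2 : (P 0).coeff 0 = 1 := by simpa using h1
        rw [h2, C_1]
      have := integral_one_sub_sq_rpow hα
      simpa [hP, weightIntegral_apply] using this
    | succ k ih =>
      have hs := h.map_mul_X_pow_succ k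
      rw [ih] at hs
      have hk : (0 : ℝ) < k + 1 + 2 * α := by positivity
      apply mul_left_cancel₀ hk.ne'
      rw [hs, show ((k + 1 : ℕ) : ℝ) + 1 + α = (k + 1 + α) + 1 by push_cast; ring,
        show ((k + 1 : ℕ) : ℝ) + 1 + 2 * α = (k + 1 + 2 * α) + 1 by push_cast; ring,
        Real.Gamma_add_one (by positivity), Real.Gamma_add_one hk.ne']
      have := hG _ hk
      field_simp
  have hmul := h.map_mul hnm hp
  rw [hT, hnorm, weightIntegral_apply] at hmul
  simp only [eval_mul, ← mul_assoc] at hmul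
  rw [hmul, ← ascPochhammer_eval_one_add_mul_Gamma hα n]
  have := hG (m + 1 + 2 * α) (by positivity)
  field_simp
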